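/- Let X be a topological space and ~ an equivalence relation on X such that the saturation of every open subset of X is open. Let Q : X → SeparationQuotient(X/~) be the composition of the quotient map X → X/~ with the Kolmogorov (T0) quotient map. Then for every subset Ω ⊆ X and every ~-saturated closed subset F ⊆ X, the set sat(Ω) ∩ F (where sat(Ω) denotes the ~-saturation of Ω) is dense in F if and only if Q(Ω) ∩ Q(F) is dense in Q(F) in the subspace topology. -/

import Mathlib

/-- The saturation of a subset `A` of `X` with respect to an equivalence
relation `s`: the union of all equivalence classes meeting `A`. -/
def Setoid.saturation {X : Type*} (s : Setoid X) (A : Set X) : Set X :=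
  {x | ∃ y ∈ A, s.r x y}

/-- The composition of the quotient map `X → X/∼` with the Kolmogorov (T0)
quotient map. -/
def kolmogorovQuotientMap {X : Type*} [TopologicalSpace X] (s : Setoid X) :
    X → SeparationQuotient (Quotient s) :=
  fun x => SeparationQuotient.mk (Quotient.mk s x)

theorem Setoid.preimage_mk_image_mk {X : Type*} (s : Setoid X) (A : Set X) :
    Quotient.mk s ⁻¹' (Quotient.mk s '' A) = s.saturation A := by
  ext x
  constructor
  · rintro ⟨y, hy, hyx⟩
    exact ⟨y, hy, s.symm (Quotient.exact hyx)⟩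
  · rintro ⟨y, hy, hxy⟩
    exact ⟨y, hy, Quotient.sound (s.symm hxy)⟩

theorem Setoid.isOpenMap_mk_of_isOpen_saturation {X : Type*} [TopologicalSpace X] (s : Setoid X)
    (hopen : ∀ U : Set X, IsOpen U → IsOpen (s.saturation U)) :
    IsOpenMap (Quotient.mk s) := fun U hU => by
  rw [← isQuotientMap_quotient_mk'.isOpen_preimage]
  exact (s.preimage_mk_image_mk U).symm ▸ hopen U hU

theorem continuous_kolmogorovQuotientMap {X : Type*} [TopologicalSpace X] (s : Setoid X) :
    Continuous (kolmogorovQuotientMap s) :=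
  SeparationQuotient.continuous_mk.comp continuous_quotient_mk'

theorem isOpenMap_kolmogorovQuotientMap {X : Type*} [TopologicalSpace X] (s : Setoid X)
    (hopen : ∀ U : Set X, IsOpen U → IsOpen (s.saturation U)) :
    IsOpenMap (kolmogorovQuotientMap s) :=
  SeparationQuotient.isOpenMap_mk.comp (s.isOpenMap_mk_of_isOpen_saturation hopen)

theorem kolmogorovQuotientMap_eq_of_rel {X : Type*} [TopologicalSpace X] {s : Setoid X} {x y : X}
    (h : s.r x y) : kolmogorovQuotientMap s x = kolmogorovQuotientMap s y :=
  congrArg SeparationQuotient.mk (Quotient.sound h)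

/-- A closed saturated set is a union of fibres of the Kolmogorov quotient map. -/
theorem mem_iff_of_kolmogorovQuotientMap_eq {X : Type*} [TopologicalSpace X] {s : Setoid X}
    {F : Set X} (hF : IsClosed F) (hsat : s.saturation F = F) {x y : X}
    (h : kolmogorovQuotientMap s x = kolmogorovQuotientMap s y) : x ∈ F ↔ y ∈ F := by
  have hpre : Quotient.mk s ⁻¹' (Quotient.mk s '' F) = F :=
    (s.preimage_mk_image_mk F).trans hsat
  have hclosed : IsClosed (Quotient.mk s '' F) := by
    rw [← isQuotientMap_quotient_mk'.isClosed_preimage]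
    exact hpre.symm ▸ hF
  have hmem := (SeparationQuotient.mk_eq_mk.1 h).mem_closed_iff hclosed
  rwa [← Set.mem_preimage, ← Set.mem_preimage, hpre] at hmem

/-- If the saturation of open sets is open, a point with the same image as a point of an open set
`U` is equivalent to some point of `U`. -/
theorem mem_saturation_of_kolmogorovQuotientMap_eq {X : Type*} [TopologicalSpace X] {s : Setoid X}
    (hopen : ∀ U : Set X, IsOpen U → IsOpen (s.saturation U)) {U : Set X} (hU : IsOpen U)
    {x y : X} (h : kolmogorovQuotientMap s x = kolmogorovQuotientMap s y) (hy : y ∈ U) :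
    x ∈ s.saturation U := by
  rw [← s.preimage_mk_image_mk]
  exact ((SeparationQuotient.mk_eq_mk.1 h).mem_open_iff
    (s.isOpenMap_mk_of_isOpen_saturation hopen U hU)).2 ⟨y, hy, rfl⟩

/-- Let `X` be a topological space and `∼` an equivalence relation on `X` such
that the saturation of every open subset is open.  Let
`Q : X → SeparationQuotient (X/∼)` be the composition of the quotient map with
the T0-quotient map.  Then for every subset `Ω ⊆ X` and every `∼`-saturated
closed subset `F ⊆ X`, the set `sat(Ω) ∩ F` is dense in `F` if and only if
`Q(Ω) ∩ Q(F)` is dense in `Q(F)` in the subspace topology. -/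
theorem saturation_dense_iff_quotient_dense {X : Type*} [TopologicalSpace X]
    (s : Setoid X)
    (hopen : ∀ U : Set X, IsOpen U → IsOpen (s.saturation U))
    (Ω F : Set X) (hF : IsClosed F) (hsat : s.saturation F = F) :
    F ⊆ closure (s.saturation Ω ∩ F) ↔
      kolmogorovQuotientMap s '' F ⊆
        closure ((kolmogorovQuotientMap s '' Ω) ∩
          (kolmogorovQuotientMap s '' F)) := by
  constructor
  · intro h
    refine (Set.image_mono h).trans
      ((image_closure_subset_closure_image (continuous_kolmogorovQuotientMap s)).trans
        (closure_mono ?_))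
    rintro _ ⟨x, ⟨⟨y, hy, hxy⟩, hx⟩, rfl⟩
    exact ⟨⟨y, hy, (kolmogorovQuotientMap_eq_of_rel hxy).symm⟩, x, hx, rfl⟩
  · intro h x hx
    rw [mem_closure_iff]
    intro U hU hxU
    obtain ⟨_, ⟨u, hu, rfl⟩, ⟨w, hw, hwu⟩, f, hf, hfu⟩ :=
      mem_closure_iff.1 (h ⟨x, hx, rfl⟩) _ (isOpenMap_kolmogorovQuotientMap s hopen U hU)
        ⟨x, hxU, rfl⟩
    obtain ⟨v, hv, hwv⟩ := mem_saturation_of_kolmogorovQuotientMap_eq hopen hU hwu hu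
    refine ⟨v, hv, ⟨w, hw, s.symm hwv⟩, ?_⟩
    refine (mem_iff_of_kolmogorovQuotientMap_eq hF hsat ?_).1 hf
    exact hfu.trans (hwu.symm.trans (kolmogorovQuotientMap_eq_of_rel hwv))
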